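/- arXiv:1802.03464 — 3 statements merged into one kernel-verified Lean document; each statement's English description precedes it below -/
import Mathlib

section
/- Let (X, ρ) be a metric space, let S₊ and S₋ be disjoint finite nonempty subsets of X, let L > 0, and let t : X → ℝ take value 1 on S₊ and −1 on S₋. For a point x ∈ X, set d₊ = min_{a∈S₊} ρ(x,a), d₋ = min_{b∈S₋} ρ(x,b), and define U_{1/2}(x) = ½·min_{a∈S₊∪S₋}(t(a) + L·ρ(x,a)) + ½·max_{a∈S₊∪S₋}(t(a) − L·ρ(x,a)). Then: if d₊ < d₋ then U_{1/2}(x) > 0, and if d₋ < d₊ then U_{1/2}(x) < 0. In other words, the sign of U_{1/2}(x) equals the label of the class containing the nearest training instance, i.e., U_{1/2} has the same classification results as the nearest neighbor classifier whenever the nearest-neighbor distances to the two classes differ. -/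
/-- The Lipschitz extension `U_{1/2}` of the `±1` labeling function has the same
classification results as the nearest neighbor classifier: if the nearest positive
training instance is strictly closer than the nearest negative one then
`U_{1/2}(x) > 0`, and conversely `U_{1/2}(x) < 0`. -/
theorem lipschitz_extension_half_eq_nn {X : Type*} [MetricSpace X] [DecidableEq X]
    (Sp Sm : Finset X) (hd : Disjoint Sp Sm) (hp : Sp.Nonempty) (hm : Sm.Nonempty)
    (L : ℝ) (hL : 0 < L) (t : X → ℝ)
    (htp : ∀ a ∈ Sp, t a = 1) (htm : ∀ b ∈ Sm, t b = -1) (x : X) :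
    ((Sp.inf' hp fun a => dist x a) < (Sm.inf' hm fun b => dist x b) →
      0 < (1 / 2) * ((Sp ∪ Sm).inf' (hp.inl) fun a => t a + L * dist x a) +
          (1 / 2) * ((Sp ∪ Sm).sup' (hp.inl) fun a => t a - L * dist x a)) ∧
    ((Sm.inf' hm fun b => dist x b) < (Sp.inf' hp fun a => dist x a) →
      (1 / 2) * ((Sp ∪ Sm).inf' (hp.inl) fun a => t a + L * dist x a) +
          (1 / 2) * ((Sp ∪ Sm).sup' (hp.inl) fun a => t a - L * dist x a) < 0) := by
  obtain ⟨a, ha, hda⟩ := Sp.exists_mem_eq_inf' hp fun a => dist x a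
  obtain ⟨b, hb, hdb⟩ := Sm.exists_mem_eq_inf' hm fun b => dist x b
  have hpos : ∀ c ∈ Sp, L * dist x a ≤ L * dist x c := fun c hc =>
    mul_le_mul_of_nonneg_left (hda ▸ Finset.inf'_le (fun a => dist x a) hc) hL.le
  have hneg : ∀ c ∈ Sm, L * dist x b ≤ L * dist x c := fun c hc =>
    mul_le_mul_of_nonneg_left (hdb ▸ Finset.inf'_le (fun b => dist x b) hc) hL.le
  rw [hda, hdb]
  constructor
  · intro h
    have hlt : L * dist x a < L * dist x b := mul_lt_mul_of_pos_left h hL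
    have hsup := Finset.le_sup' (fun c => t c - L * dist x c) (Finset.mem_union_left Sm ha)
    obtain ⟨c, hc, hinf⟩ := (Sp ∪ Sm).exists_mem_eq_inf' hp.inl fun c => t c + L * dist x c
    rw [hinf]
    simp only [htp a ha] at hsup
    rcases Finset.mem_union.1 hc with hc | hc
    · linarith [hpos c hc, htp c hc]
    · linarith [hneg c hc, htm c hc]
  · intro h
    have hlt : L * dist x b < L * dist x a := mul_lt_mul_of_pos_left h hL
    have hinf := Finset.inf'_le (fun c => t c + L * dist x c) (Finset.mem_union_right Sp hb)
    obtain ⟨c, hc, hsup⟩ := (Sp ∪ Sm).exists_mem_eq_sup' hp.inl fun c => t c - L * dist x c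
    rw [hsup]
    simp only [htm b hb] at hinf
    rcases Finset.mem_union.1 hc with hc | hc
    · linarith [hpos c hc, htp c hc]
    · linarith [hneg c hc, htm c hc]
end

section
/- Let E be a Euclidean space (a finite-dimensional real inner product space with the Euclidean distance ρ_E(x,y) = ‖x − y‖). Let f : E → ℝ be continuous, let S₁, S₋₁ ⊆ E be finite nonempty sets with f(x) ≥ 1 for all x ∈ S₁ and f(y) ≤ −1 for all y ∈ S₋₁, and let H_f = {h ∈ E : f(h) = 0} be the decision boundary of f. Then D(S₁, S₋₁) ≥ 2·D(S₁ ∪ S₋₁, H_f), where D(S₁, S₋₁) = min_{x∈S₁, y∈S₋₁} ρ_E(x,y) and D(S, H_f) = min_{x∈S} inf_{h∈H_f} ρ_E(x,h). -/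
/-- A real function that is continuous on the segment from `y` to `x`, nonpositive at `y` and
nonnegative at `x`, vanishes somewhere on that segment. -/
theorem exists_mem_segment_eq_zero {E : Type*} [NormedAddCommGroup E] [NormedSpace ℝ E]
    {f : E → ℝ} {x y : E} (hf : ContinuousOn f (segment ℝ y x)) (hy : f y ≤ 0) (hx : 0 ≤ f x) :
    ∃ h ∈ segment ℝ y x, f h = 0 :=
  (convex_segment y x).isPreconnected.intermediate_value (left_mem_segment ℝ y x)
    (right_mem_segment ℝ y x) hf ⟨hy, hx⟩

/-- In a Euclidean space, for any continuous `f` with `f ≥ 1` on `S₁` and `f ≤ -1`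
on `S₋₁`, the Lipschitz margin `D(S₁, S₋₁)` is at least twice the SVM-style margin
`D(S₁ ∪ S₋₁, H_f)` to the decision boundary `H_f = {h : f h = 0}`. -/
theorem lipschitz_margin_ge_two_svm_margin
    {E : Type*} [NormedAddCommGroup E] [InnerProductSpace ℝ E] [FiniteDimensional ℝ E]
    [DecidableEq E]
    (f : E → ℝ) (hf : Continuous f)
    (S₁ Sm : Finset E) (h₁ : S₁.Nonempty) (hm : Sm.Nonempty)
    (hf₁ : ∀ x ∈ S₁, 1 ≤ f x) (hfm : ∀ y ∈ Sm, f y ≤ -1) :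
    2 * ((S₁ ∪ Sm).inf' (h₁.inl) fun x => Metric.infDist x {h : E | f h = 0}) ≤
      S₁.inf' h₁ fun x => Sm.inf' hm fun y => dist x y := by
  refine Finset.le_inf' _ _ fun x hx => Finset.le_inf' _ _ fun y hy => ?_
  obtain ⟨h, hseg, hh⟩ := exists_mem_segment_eq_zero hf.continuousOn
    ((hfm y hy).trans (by norm_num)) (zero_le_one.trans (hf₁ x hx))
  have hxh : Metric.infDist x {h : E | f h = 0} ≤ dist x h := Metric.infDist_le_dist_of_mem hh
  have hyh : Metric.infDist y {h : E | f h = 0} ≤ dist y h := Metric.infDist_le_dist_of_mem hh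
  have hx' := Finset.inf'_le (fun x => Metric.infDist x {h : E | f h = 0})
    (Finset.mem_union_left Sm hx)
  have hy' := Finset.inf'_le (fun x => Metric.infDist x {h : E | f h = 0})
    (Finset.mem_union_right S₁ hy)
  have hsum := dist_add_dist_of_mem_segment hseg
  rw [dist_comm h x, dist_comm y x] at hsum
  linarith
end

section
/- Let n ≥ 1, λ > 0, v ∈ ℝⁿ, and suppose t* ∈ ℝ satisfies Σᵢ (1/λ)·max(0, vᵢ − t*) = 1. Define x* ∈ ℝⁿ by x*ᵢ = min(t*, vᵢ). Then x* minimizes F(x) = maxᵢ xᵢ + (1/(2λ))·Σᵢ (xᵢ − vᵢ)² over x ∈ ℝⁿ: for every x ∈ ℝⁿ, F(x*) ≤ F(x). -/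
/-- The tangent-line bound behind the optimality of the threshold `t`: if `x ≤ M`, then moving the
truncation `min t a` to `x` changes the squared distance to `a` by at least `2 (t - M) max 0 (a - t)`. -/
theorem sq_min_sub_add_le_sq_sub {t a x M : ℝ} (hx : x ≤ M) :
    (min t a - a) ^ 2 + 2 * (t - M) * max 0 (a - t) ≤ (x - a) ^ 2 := by
  rcases le_total a t with h | h
  · rw [min_eq_right h, max_eq_left (by linarith)]
    nlinarith [sq_nonneg (x - a)]
  · rw [min_eq_left h, max_eq_right (by linarith)]
    nlinarith [sq_nonneg (x - t), mul_nonneg (sub_nonneg.2 h) (sub_nonneg.2 hx)]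

/-- The proximal operator of the pointwise maximum: if `t*` satisfies
`∑ᵢ (1/λ)·max(0, vᵢ − t*) = 1`, then `x*ᵢ = min(t*, vᵢ)` minimizes
`F(x) = maxᵢ xᵢ + (1/(2λ))·∑ᵢ (xᵢ − vᵢ)²` over `x ∈ ℝⁿ`. -/
theorem max_prox_minimizer (n : ℕ) (hn : 1 ≤ n)
    (hne : (Finset.univ : Finset (Fin n)).Nonempty)
    (lam : ℝ) (hlam : 0 < lam) (v : Fin n → ℝ) (tstar : ℝ)
    (ht : ∑ i, (1 / lam) * max 0 (v i - tstar) = 1) :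
    ∀ x : Fin n → ℝ,
      Finset.univ.sup' hne (fun i => min tstar (v i)) +
          (1 / (2 * lam)) * ∑ i, (min tstar (v i) - v i) ^ 2 ≤
        Finset.univ.sup' hne x + (1 / (2 * lam)) * ∑ i, (x i - v i) ^ 2 := by
  intro x
  set M := Finset.univ.sup' hne x
  have hsup : Finset.univ.sup' hne (fun i => min tstar (v i)) ≤ tstar :=
    Finset.sup'_le hne _ fun i _ => min_le_left _ _
  have hsum : ∑ i, max 0 (v i - tstar) = lam := by
    rw [← Finset.mul_sum] at ht
    field_simp at ht
    exact ht
  have hsq : ∑ i, (min tstar (v i) - v i) ^ 2 + 2 * (tstar - M) * lam ≤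
      ∑ i, (x i - v i) ^ 2 := by
    rw [← hsum, Finset.mul_sum, ← Finset.sum_add_distrib]
    exact Finset.sum_le_sum fun i hi => sq_min_sub_add_le_sq_sub (Finset.le_sup' x hi)
  have hscaled := mul_le_mul_of_nonneg_left hsq (by positivity : 0 ≤ 1 / (2 * lam))
  have hcancel : 1 / (2 * lam) * (2 * (tstar - M) * lam) = tstar - M := by
    field_simp
  rw [mul_add, hcancel] at hscaled
  linarith
end
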